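/- There exist constants K > 1 and c > 0 with the following property. For any vertex v = (x,y) ∈ Z^2 (the 'tip') and any vertex p ∈ Z^2 lying to the left of v (i.e., with first coordinate less than x) at distance ρ = |p − v| ≥ 1, the probability that simple random walk started at p hits the ray {(x',y) : x' ≥ x} for the first time at the tip v, before exiting the disk of radius K·ρ centered at v, is at least c·ρ^{−1/2}. Equivalently, this probability is at least half of the unrestricted probability that SRW from p first hits the ray at the tip. -/

import Mathlib

open MeasureTheory
open scoped Classical

noncomputable section

/-- Step distribution of the excited random walk on `ℤ²` with bias `ε/2`:
on a first visit to a vertex (`first` holds) the walker steps right with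
probability `(1+ε)/4`, left with probability `(1-ε)/4`, and up or down with
probability `1/4` each; on subsequent visits all four neighbors have
probability `1/4`.  For `ε = 0` this is the step distribution of simple
random walk. -/
def erw2StepProb (ε : ℝ) (first : Prop) (s : ℤ × ℤ) : ℝ :=
  if s = (1, 0) then (1 + if first then ε else 0) / 4
  else if s = (-1, 0) then (1 - if first then ε else 0) / 4
  else if s = (0, 1) ∨ s = (0, -1) then 1 / 4
  else 0

/-- `X` is an excited random walk on `ℤ²` with bias `ε/2`, started at `v`, under
the probability measure `P`: conditionally on any initial history, the next step
has the distribution `erw2StepProb`, where "first visit" means that the current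
position was not visited at any earlier time. -/
structure IsERW2 (ε : ℝ) (v : ℤ × ℤ) {Ω : Type*} [MeasurableSpace Ω]
    (P : Measure Ω) (X : ℕ → Ω → ℤ × ℤ) : Prop where
  isProb : IsProbabilityMeasure P
  meas : ∀ n, Measurable (X n)
  start : ∀ᵐ ω ∂P, X 0 ω = v
  step : ∀ (n : ℕ) (h : ℕ → ℤ × ℤ) (s : ℤ × ℤ),
    P ({ω | X (n + 1) ω = h n + s} ∩ {ω | ∀ k ≤ n, X k ω = h k}) =
      ENNReal.ofReal (erw2StepProb ε (∀ k < n, h k ≠ h n) s) *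
        P {ω | ∀ k ≤ n, X k ω = h k}

/-- Simple random walk on `ℤ²` started at `v` (excited random walk with bias `0`). -/
abbrev IsSRW2 (v : ℤ × ℤ) {Ω : Type*} [MeasurableSpace Ω]
    (P : Measure Ω) (X : ℕ → Ω → ℤ × ℤ) : Prop := IsERW2 0 v P X

/-- `v` is a tan point for the walk `X` in outcome `ω`: `v` is visited before any
point of the form `(x', v.2)` with `x' > v.1`. -/
def IsTanPoint {Ω : Type*} (X : ℕ → Ω → ℤ × ℤ) (ω : Ω) (v : ℤ × ℤ) : Prop :=
  ∃ n, X n ω = v ∧ ∀ m < n, ¬((X m ω).2 = v.2 ∧ v.1 < (X m ω).1)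

/-- `v` is a tan point for the walk `X` in outcome `ω`, witnessed strictly before
time `N`: `v` is visited at some time `n < N`, before any point `(x', v.2)` with
`x' > v.1`. -/
def TanPointBy {Ω : Type*} (X : ℕ → Ω → ℤ × ℤ) (ω : Ω) (v : ℤ × ℤ) (N : ℕ) : Prop :=
  ∃ n < N, X n ω = v ∧ ∀ m < n, ¬((X m ω).2 = v.2 ∧ v.1 < (X m ω).1)

/-- The polar radius `r = sqrt (x² + y²)` of a lattice point. -/
def polarR (v : ℤ × ℤ) : ℝ := Real.sqrt ((v.1 : ℝ) ^ 2 + (v.2 : ℝ) ^ 2)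

/-- The polar angle `θ ∈ [0, 2π)` of a lattice point, so that
`x = r cos θ` and `y = r sin θ`. -/
def polarTheta (v : ℤ × ℤ) : ℝ :=
  if 0 ≤ Complex.arg ⟨(v.1 : ℝ), (v.2 : ℝ)⟩ then Complex.arg ⟨(v.1 : ℝ), (v.2 : ℝ)⟩
  else Complex.arg ⟨(v.1 : ℝ), (v.2 : ℝ)⟩ + 2 * Real.pi

/-- The function `Re (z ^ (-1/2))`, written in real terms; it vanishes on the negative real axis. -/
def reInvSqrt (z : ℂ) : ℝ := Real.sqrt ((‖z‖ + z.re) / 2) / ‖z‖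

lemma reInvSqrt_sq {s : ℂ} (hs : 0 ≤ s.re) : reInvSqrt (s ^ 2) = (s⁻¹).re := by
  have h1 : ‖s ^ 2‖ = s.re ^ 2 + s.im ^ 2 := by
    rw [norm_pow, Complex.sq_norm, Complex.normSq_apply]; ring
  have h2 : (s ^ 2).re = s.re ^ 2 - s.im ^ 2 := by
    rw [sq, Complex.mul_re]; ring
  rw [reInvSqrt, h1, h2, Complex.inv_re, Complex.normSq_apply]
  have : (s.re ^ 2 + s.im ^ 2 + (s.re ^ 2 - s.im ^ 2)) / 2 = s.re ^ 2 := by ring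
  rw [this, Real.sqrt_sq hs]
  ring_nf

lemma exists_sq_eq_re_nonneg (z : ℂ) : ∃ s : ℂ, s ^ 2 = z ∧ 0 ≤ s.re := by
  obtain ⟨s, hs⟩ := IsAlgClosed.exists_pow_nat_eq z (n := 2) (by norm_num)
  rcases le_total 0 s.re with h | h
  · exact ⟨s, hs, h⟩
  · exact ⟨-s, by rw [neg_sq, hs], by simpa using h⟩

lemma exists_reInvSqrt_add {z s d : ℂ} (hz : z + d ≠ 0) (hs : s ^ 2 = z) (hs0 : s ≠ 0)
    (hre : 0 ≤ s.re)
    (hd : (0 < z.im ∧ 0 ≤ (z + d).im) ∨ (z.im < 0 ∧ (z + d).im ≤ 0) ∨ (z.im = 0 ∧ 0 < z.re)) :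
    ∃ e : ℂ, reInvSqrt (z + d) = (s⁻¹ * e).re ∧ e ^ 2 * (1 + d * z⁻¹) = 1 ∧ 0 ≤ e.re := by
  have hz0 : z ≠ 0 := by rw [← hs]; exact pow_ne_zero _ hs0
  have key : ∃ s' : ℂ, s' ^ 2 = z + d ∧ 0 ≤ s'.re ∧ 0 ≤ s.re * s'.re + s.im * s'.im := by
    obtain ⟨s', h1, h2⟩ := exists_sq_eq_re_nonneg (z + d)
    have i1 : z.im = 2 * s.re * s.im := by rw [← hs, sq, Complex.mul_im]; ring
    have i2 : (z + d).im = 2 * s'.re * s'.im := by rw [← h1, sq, Complex.mul_im]; ring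
    have i3 : z.re = s.re ^ 2 - s.im ^ 2 := by rw [← hs, sq, Complex.mul_re]; ring
    rcases h2.eq_or_lt with h0 | h0
    · rcases le_total 0 (s.im * s'.im) with h | h
      · exact ⟨s', h1, h2, by rw [← h0]; linarith⟩
      · exact ⟨-s', by rw [neg_sq, h1], by simp [← h0], by simp [← h0]; linarith⟩
    · refine ⟨s', h1, h2, ?_⟩
      have hp := mul_nonneg hre h2
      rcases hd with ⟨a, b⟩ | ⟨a, b⟩ | ⟨a, b⟩
      · have : 0 < s.im := by
          by_contra hh; push Not at hh
          nlinarith [mul_nonneg hre (neg_nonneg.2 hh)]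
        have : 0 ≤ s'.im := by
          by_contra hh; push Not at hh
          nlinarith [mul_pos h0 (neg_pos.2 hh)]
        positivity
      · have : s.im < 0 := by
          by_contra hh; push Not at hh
          nlinarith [mul_nonneg hre hh]
        have : s'.im ≤ 0 := by
          by_contra hh; push Not at hh
          nlinarith [mul_pos h0 hh]
        nlinarith
      · have : s.im = 0 := by
          have h3 : s.re * s.im = 0 := by linarith
          rcases mul_eq_zero.1 h3 with h | h
          · rw [h] at i3; nlinarith [sq_nonneg s.im]
          · exact h
        rw [this]; linarith
  obtain ⟨s', h1, h2, h3⟩ := key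
  have hs' : s' ≠ 0 := by rintro rfl; apply hz; rw [← h1]; simp
  refine ⟨s * s'⁻¹, ?_, ?_, ?_⟩
  · rw [← h1, reInvSqrt_sq h2, inv_mul_cancel_left₀ hs0]
  · have : d = s' ^ 2 - z := by rw [h1]; ring
    rw [this, ← hs]; field_simp; ring
  · rw [Complex.mul_re, Complex.inv_re, Complex.inv_im]
    have : 0 < Complex.normSq s' := Complex.normSq_pos.2 hs'
    have : s.re * (s'.re / Complex.normSq s') - s.im * (-s'.im / Complex.normSq s')
      = (s.re * s'.re + s.im * s'.im) / Complex.normSq s' := by ring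
    rw [this]; positivity

lemma norm_invSqrt_taylor_two {e t : ℂ} (he : e ^ 2 * (1 + t) = 1) (hre : 0 ≤ e.re)
    (ht : ‖t‖ ≤ 1 / 4) : ‖e - (1 - t / 2 + 3 / 8 * t ^ 2)‖ ≤ 4 * ‖t‖ ^ 3 := by
  set p : ℂ := 1 - t / 2 + 3 / 8 * t ^ 2 with hp
  have hid : (e - p) * ((e + p) * (1 + t)) = -(t ^ 3 * (5 / 8 - 15 / 64 * t + 9 / 64 * t ^ 2)) := by
    have : (e - p) * ((e + p) * (1 + t)) = e ^ 2 * (1 + t) - p ^ 2 * (1 + t) := by ring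
    rw [this, he, hp]; ring
  have hn0 := norm_nonneg t
  have hpn : ‖1 - p‖ ≤ 1 / 4 := by
    have : 1 - p = t / 2 - 3 / 8 * t ^ 2 := by rw [hp]; ring
    rw [this]
    refine (norm_sub_le _ _).trans ?_
    simp only [norm_div, norm_mul, norm_pow]
    norm_num
    nlinarith
  have hpre : 3 / 4 ≤ p.re := by
    have := (Complex.abs_re_le_norm (1 - p)).trans hpn
    rw [abs_le] at this
    simp only [Complex.sub_re, Complex.one_re] at this
    linarith [this.2]
  have h1 : 3 / 4 ≤ ‖e + p‖ := by
    refine le_trans ?_ (Complex.re_le_norm _)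
    rw [Complex.add_re]; linarith
  have h2 : 3 / 4 ≤ ‖1 + t‖ := by
    have := norm_sub_le (1 + t) t
    simp only [add_sub_cancel_right, norm_one] at this
    linarith
  have h3 : ‖5 / 8 - 15 / 64 * t + 9 / 64 * t ^ 2‖ ≤ 1 := by
    refine (norm_add_le _ _).trans ?_
    refine (add_le_add_left (norm_sub_le _ _) _).trans ?_
    simp only [norm_div, norm_mul, norm_pow]
    norm_num
    nlinarith
  have h4 := congrArg norm hid
  rw [norm_mul, norm_mul, norm_neg, norm_mul, norm_pow] at h4
  have h5 : 9 / 16 ≤ ‖e + p‖ * ‖1 + t‖ := by nlinarith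
  have h6 : ‖e - p‖ * (9 / 16) ≤ ‖e - p‖ * (‖e + p‖ * ‖1 + t‖) :=
    mul_le_mul_of_nonneg_left h5 (norm_nonneg _)
  have h7 : ‖t‖ ^ 3 * ‖5 / 8 - 15 / 64 * t + 9 / 64 * t ^ 2‖ ≤ ‖t‖ ^ 3 * 1 :=
    mul_le_mul_of_nonneg_left h3 (by positivity)
  nlinarith [pow_nonneg hn0 3]

lemma norm_invSqrt_taylor_one {e t : ℂ} (he : e ^ 2 * (1 + t) = 1) (hre : 0 ≤ e.re)
    (ht : ‖t‖ ≤ 1 / 4) : ‖e - (1 - t / 2)‖ ≤ 2 * ‖t‖ ^ 2 := by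
  have h := norm_invSqrt_taylor_two he hre ht
  have : e - (1 - t / 2) = (e - (1 - t / 2 + 3 / 8 * t ^ 2)) + 3 / 8 * t ^ 2 := by ring
  rw [this]
  refine (norm_add_le _ _).trans ?_
  simp only [norm_div, norm_mul, norm_pow]
  norm_num
  nlinarith [mul_le_mul_of_nonneg_right ht (sq_nonneg ‖t‖)]

/-- For a lattice-like neighbourhood not crossing the slit, the sum of the increments of
`reInvSqrt` is much smaller than the sum of their squares. -/
lemma reInvSqrt_sum_increments_lt {z : ℂ} (hz : 10 ^ 6 ≤ ‖z‖)
    (hd : ∀ d : ℂ, d = 1 ∨ d = -1 ∨ d = Complex.I ∨ d = -Complex.I →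
      (0 < z.im ∧ 0 ≤ (z + d).im) ∨ (z.im < 0 ∧ (z + d).im ≤ 0) ∨ (z.im = 0 ∧ 0 < z.re)) :
    3 * |(reInvSqrt (z + 1) - reInvSqrt z) + (reInvSqrt (z + -1) - reInvSqrt z)
      + (reInvSqrt (z + Complex.I) - reInvSqrt z) + (reInvSqrt (z + -Complex.I) - reInvSqrt z)|
    < (reInvSqrt (z + 1) - reInvSqrt z) ^ 2 + (reInvSqrt (z + -1) - reInvSqrt z) ^ 2
      + (reInvSqrt (z + Complex.I) - reInvSqrt z) ^ 2
      + (reInvSqrt (z + -Complex.I) - reInvSqrt z) ^ 2 := by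
  obtain ⟨s, hs, hre⟩ := exists_sq_eq_re_nonneg z
  have hz0 : z ≠ 0 := by rintro rfl; norm_num at hz
  have hs0 : s ≠ 0 := by rintro rfl; apply hz0; rw [← hs]; simp
  have hne : ∀ d : ℂ, ‖d‖ = 1 → z + d ≠ 0 := by
    intro d h h0
    have : z = -d := eq_neg_of_add_eq_zero_left h0
    rw [this, norm_neg, h] at hz; norm_num at hz
  obtain ⟨e1, f1, q1, r1⟩ := exists_reInvSqrt_add (hne 1 (by simp)) hs hs0 hre (hd 1 (by simp))
  obtain ⟨e2, f2, q2, r2⟩ :=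
    exists_reInvSqrt_add (hne (-1) (by simp)) hs hs0 hre (hd (-1) (by simp))
  obtain ⟨e3, f3, q3, r3⟩ :=
    exists_reInvSqrt_add (hne Complex.I (by simp)) hs hs0 hre (hd Complex.I (by simp))
  obtain ⟨e4, f4, q4, r4⟩ :=
    exists_reInvSqrt_add (hne (-Complex.I) (by simp)) hs hs0 hre (hd (-Complex.I) (by simp))
  have f0 : reInvSqrt z = (s⁻¹).re := by rw [← hs, reInvSqrt_sq hre]
  set t : ℂ := z⁻¹ with ht
  set b : ℂ := s⁻¹ with hb
  set u : ℝ := ‖b‖ with hu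
  have hu0 : 0 < u := by rw [hu, norm_pos_iff, hb]; exact inv_ne_zero hs0
  have htu : ‖t‖ = u ^ 2 := by rw [ht, hu, hb, ← norm_pow, inv_pow, hs]
  have hu1 : u ≤ 1 / 1000 := by
    have : u ^ 2 ≤ (1 / 1000) ^ 2 := by
      rw [← htu, ht, norm_inv]
      calc ‖z‖⁻¹ ≤ (10 ^ 6)⁻¹ := inv_anti₀ (by norm_num) hz
        _ = _ := by norm_num
    exact (pow_le_pow_iff_left₀ hu0.le (by norm_num) (by norm_num)).1 this
  have hnt : ∀ d : ℂ, ‖d‖ = 1 → ‖d * t‖ = u ^ 2 := by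
    intro d h; rw [norm_mul, h, one_mul, htu]
  have hq : u ^ 2 ≤ 1 / 4 := by nlinarith
  have n1 := hnt 1 (by simp)
  have n2 := hnt (-1) (by simp)
  have n3 := hnt Complex.I (by simp)
  have n4 := hnt (-Complex.I) (by simp)
  have T1 := norm_invSqrt_taylor_two q1 r1 (n1.trans_le hq)
  have T2 := norm_invSqrt_taylor_two q2 r2 (n2.trans_le hq)
  have T3 := norm_invSqrt_taylor_two q3 r3 (n3.trans_le hq)
  have T4 := norm_invSqrt_taylor_two q4 r4 (n4.trans_le hq)
  have S1 := norm_invSqrt_taylor_one q1 r1 (n1.trans_le hq)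
  have S2 := norm_invSqrt_taylor_one q2 r2 (n2.trans_le hq)
  have S3 := norm_invSqrt_taylor_one q3 r3 (n3.trans_le hq)
  have S4 := norm_invSqrt_taylor_one q4 r4 (n4.trans_le hq)
  rw [n1] at T1 S1
  rw [n2] at T2 S2
  rw [n3] at T3 S3
  rw [n4] at T4 S4
  rw [f0, f1, f2, f3, f4]
  set a : ℂ := b * (t / 2) with ha
  have inc : ∀ (e d : ℂ), ‖e - (1 - d * t / 2)‖ ≤ 2 * (u ^ 2) ^ 2 →
      |((b * e).re - b.re) + (d * a).re| ≤ 2 * u ^ 5 := by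
    intro e d h
    have h1 : ((b * e).re - b.re) + (d * a).re = (b * (e - (1 - d * t / 2))).re := by
      rw [← Complex.sub_re, ← Complex.add_re, ha]; congr 1; ring
    rw [h1]
    refine (Complex.abs_re_le_norm _).trans ?_
    rw [norm_mul]
    calc ‖b‖ * ‖e - (1 - d * t / 2)‖ ≤ u * (2 * (u ^ 2) ^ 2) := by gcongr
      _ = _ := by ring
  have I1 := inc e1 1 S1
  have I2 := inc e2 (-1) S2
  have I3 := inc e3 Complex.I S3
  have I4 := inc e4 (-Complex.I) S4
  have hsum : ((b * e1).re - b.re) + ((b * e2).re - b.re) + ((b * e3).re - b.re)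
      + ((b * e4).re - b.re) = (b * ((e1 - (1 - 1 * t / 2 + 3 / 8 * (1 * t) ^ 2))
        + (e2 - (1 - -1 * t / 2 + 3 / 8 * (-1 * t) ^ 2))
        + (e3 - (1 - Complex.I * t / 2 + 3 / 8 * (Complex.I * t) ^ 2))
        + (e4 - (1 - -Complex.I * t / 2 + 3 / 8 * (-Complex.I * t) ^ 2)))).re := by
    simp only [← Complex.sub_re, ← Complex.add_re]
    congr 1
    linear_combination (3 / 4 * b * t ^ 2) * Complex.I_sq
  have hL : |((b * e1).re - b.re) + ((b * e2).re - b.re) + ((b * e3).re - b.re)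
      + ((b * e4).re - b.re)| ≤ 16 * u ^ 7 := by
    rw [hsum]
    refine (Complex.abs_re_le_norm _).trans ?_
    rw [norm_mul]
    calc _ ≤ u * (4 * (u ^ 2) ^ 3 + 4 * (u ^ 2) ^ 3 + 4 * (u ^ 2) ^ 3 + 4 * (u ^ 2) ^ 3) := by
          gcongr
          refine (norm_add_le _ _).trans (add_le_add ?_ T4)
          refine (norm_add_le _ _).trans (add_le_add ?_ T3)
          exact (norm_add_le _ _).trans (add_le_add T1 T2)
      _ = _ := by ring
  have hna : a.re ^ 2 + a.im ^ 2 = u ^ 6 / 4 := by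
    have h1 : a.re ^ 2 + a.im ^ 2 = ‖a‖ ^ 2 := by
      rw [Complex.sq_norm, Complex.normSq_apply]; ring
    rw [h1, ha, norm_mul, norm_div, htu]
    norm_num; ring
  simp only [one_mul, neg_mul, Complex.neg_re, Complex.I_mul_re, neg_neg] at I1 I2 I3 I4
  have sqb : ∀ x y c : ℝ, |x + y| ≤ c → y ^ 2 / 2 - c ^ 2 ≤ x ^ 2 := by
    intro x y c h
    have : (x + y) ^ 2 ≤ c ^ 2 := sq_le_sq' (by linarith [(abs_le.1 h).1]) (abs_le.1 h).2
    nlinarith [sq_nonneg (2 * x + y)]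
  have J1 := sqb _ _ _ I1
  have J2 := sqb _ _ _ I2
  have J3 := sqb _ _ _ I3
  have J4 := sqb _ _ _ I4
  have hfin : 48 * u ^ 7 + 16 * u ^ 10 < u ^ 6 / 4 := by
    have h6 : 0 < u ^ 6 := by positivity
    have h4 : u ^ 4 ≤ 1 / 1000 := by
      calc u ^ 4 ≤ (1 / 1000) ^ 4 := by gcongr
        _ ≤ _ := by norm_num
    have e1 : u ^ 7 = u ^ 6 * u := by ring
    have e2 : u ^ 10 = u ^ 6 * u ^ 4 := by ring
    rw [e1, e2]
    linarith [mul_le_mul_of_nonneg_left hu1 h6.le, mul_le_mul_of_nonneg_left h4 h6.le]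
  have e5 : (2 * u ^ 5) ^ 2 = 4 * u ^ 10 := by ring
  rw [e5] at J1 J2 J3 J4
  linarith

/-- The four unit steps of the square lattice. -/
def unitSteps : Finset (ℤ × ℤ) := {(1, 0), (-1, 0), (0, 1), (0, -1)}

lemma sum_unitSteps {M : Type*} [AddCommMonoid M] (u : ℤ × ℤ → M) :
    ∑ d ∈ unitSteps, u d = u (1, 0) + (u (-1, 0) + (u (0, 1) + u (0, -1))) := by
  simp [unitSteps]

lemma sum_const_unitSteps (a : ℝ) : ∑ _d ∈ unitSteps, a = 4 * a := by
  rw [sum_unitSteps]; ring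

/-- The complement of the horizontal ray `{(x, 0) : x ≥ 0}`. -/
def offRay : Set (ℤ × ℤ) := {q | ¬(q.2 = 0 ∧ 0 ≤ q.1)}

/-- The lattice point `q`, reflected through the origin and seen as a complex number. -/
def negToComplex (q : ℤ × ℤ) : ℂ := ⟨-(q.1 : ℝ), -(q.2 : ℝ)⟩

lemma norm_negToComplex (q : ℤ × ℤ) : ‖negToComplex q‖ = polarR q := by
  rw [polarR, Complex.norm_def, Complex.normSq_apply]
  congr 1
  simp only [negToComplex]; ring

lemma negToComplex_add (q d : ℤ × ℤ) :
    negToComplex (q + d) = negToComplex q + negToComplex d := by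
  apply Complex.ext
  · simp [negToComplex]; ring
  · simp [negToComplex]; ring

lemma polarR_step {d : ℤ × ℤ} (hd : d ∈ unitSteps) : polarR d = 1 := by
  simp only [unitSteps, Finset.mem_insert, Finset.mem_singleton] at hd
  rcases hd with rfl | rfl | rfl | rfl <;> simp [polarR]

lemma polarR_add_step_ge (q : ℤ × ℤ) {d : ℤ × ℤ} (hd : d ∈ unitSteps) :
    polarR q - 1 ≤ polarR (q + d) := by
  rw [← polarR_step hd, ← norm_negToComplex, ← norm_negToComplex, ← norm_negToComplex,
    negToComplex_add]
  have := norm_sub_le (negToComplex q + negToComplex d) (negToComplex d)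
  rw [add_sub_cancel_right] at this
  linarith

lemma one_le_polarR {q : ℤ × ℤ} (hq : q ≠ 0) : 1 ≤ polarR q := by
  rw [polarR, Real.one_le_sqrt]
  have : 1 ≤ q.1 ^ 2 + q.2 ^ 2 := by
    by_contra h
    apply hq
    have h1 : q.1 ^ 2 = 0 := by nlinarith [sq_nonneg q.1, sq_nonneg q.2]
    have h2 : q.2 ^ 2 = 0 := by nlinarith [sq_nonneg q.1, sq_nonneg q.2]
    exact Prod.ext (pow_eq_zero_iff (two_ne_zero) |>.1 h1) (pow_eq_zero_iff (two_ne_zero) |>.1 h2)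
  exact_mod_cast this

lemma finite_polarR_le (r : ℝ) : {q : ℤ × ℤ | polarR q ≤ r}.Finite := by
  refine ((Set.finite_Icc (-⌈r⌉) ⌈r⌉).prod (Set.finite_Icc (-⌈r⌉) ⌈r⌉)).subset ?_
  intro q hq
  have hq' : polarR q ≤ ⌈r⌉ := le_trans hq (Int.le_ceil r)
  have h1 : |(q.1 : ℝ)| ≤ ⌈r⌉ :=
    le_trans (by rw [polarR]; exact Real.abs_le_sqrt (by nlinarith [sq_nonneg (q.2 : ℝ)])) hq'
  have h2 : |(q.2 : ℝ)| ≤ ⌈r⌉ :=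
    le_trans (by rw [polarR]; exact Real.abs_le_sqrt (by nlinarith [sq_nonneg (q.1 : ℝ)])) hq'
  have h1' : |q.1| ≤ ⌈r⌉ := by exact_mod_cast h1
  have h2' : |q.2| ≤ ⌈r⌉ := by exact_mod_cast h2
  exact ⟨abs_le.1 h1', abs_le.1 h2'⟩

/-- The lattice version of `Re ((-z) ^ (-1/2))`, almost harmonic away from the ray. -/
def tipFun (q : ℤ × ℤ) : ℝ := reInvSqrt (negToComplex q)

lemma tipFun_eq (q : ℤ × ℤ) :
    tipFun q = Real.sqrt ((polarR q - q.1) / 2) / polarR q := by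
  rw [tipFun, reInvSqrt, norm_negToComplex]
  simp [negToComplex, sub_eq_add_neg]

lemma polarR_nonneg (q : ℤ × ℤ) : 0 ≤ polarR q := Real.sqrt_nonneg _

lemma polarR_sq (q : ℤ × ℤ) : polarR q ^ 2 = (q.1 : ℝ) ^ 2 + (q.2 : ℝ) ^ 2 := by
  rw [polarR, Real.sq_sqrt (by positivity)]

lemma tipFun_nonneg (q : ℤ × ℤ) : 0 ≤ tipFun q := by
  rw [tipFun_eq]; exact div_nonneg (Real.sqrt_nonneg _) (polarR_nonneg q)

lemma tipFun_eq_zero {q : ℤ × ℤ} (hq : q ∉ offRay) : tipFun q = 0 := by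
  simp only [offRay, Set.mem_ofPred_eq, not_not] at hq
  have : polarR q = q.1 := by
    rw [polarR, hq.1]
    simp only [Int.cast_zero, ne_eq, OfNat.ofNat_ne_zero, not_false_eq_true, zero_pow, add_zero]
    exact Real.sqrt_sq (by exact_mod_cast hq.2)
  rw [tipFun_eq, this]; simp

lemma abs_fst_le_polarR (q : ℤ × ℤ) : |(q.1 : ℝ)| ≤ polarR q := by
  rw [polarR]; exact Real.abs_le_sqrt (by nlinarith [sq_nonneg (q.2 : ℝ)])

lemma tipFun_le {q : ℤ × ℤ} (hq : q ≠ 0) : tipFun q ≤ 1 / Real.sqrt (polarR q) := by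
  have h1 := one_le_polarR hq
  have h2 := (abs_le.1 (abs_fst_le_polarR q)).1
  rw [tipFun_eq, ← Real.sqrt_div_self']
  gcongr
  linarith

lemma tipFun_le_one {q : ℤ × ℤ} (hq : q ≠ 0) : tipFun q ≤ 1 := by
  refine (tipFun_le hq).trans ?_
  have := Real.one_le_sqrt.2 (one_le_polarR hq)
  exact div_le_one_of_le₀ this (by positivity)

lemma le_tipFun_of_fst_neg {q : ℤ × ℤ} (hq : q.1 < 0) :
    7 / 10 / Real.sqrt (polarR q) ≤ tipFun q := by
  have h0 : q ≠ 0 := by rintro rfl; simp at hq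
  have h1 := one_le_polarR h0
  have h2 : (q.1 : ℝ) < 0 := by exact_mod_cast hq
  have h3 : Real.sqrt (polarR q) ^ 2 = polarR q := Real.sq_sqrt (by linarith)
  have h4 : 0 < Real.sqrt (polarR q) := Real.sqrt_pos.2 (by linarith)
  rw [tipFun_eq, div_le_div_iff₀ h4 (by linarith)]
  have h5 : 7 / 10 * Real.sqrt (polarR q) ≤ Real.sqrt ((polarR q - q.1) / 2) :=
    Real.le_sqrt_of_sq_le (by rw [mul_pow, h3]; linarith)
  calc 7 / 10 * polarR q = (7 / 10 * Real.sqrt (polarR q)) * Real.sqrt (polarR q) := by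
        rw [mul_assoc, ← sq, h3]
    _ ≤ _ := by gcongr

lemma le_tipFun_of_mem_offRay {q : ℤ × ℤ} (hq : q ∈ offRay) :
    1 / (2 * polarR q ^ 2) ≤ tipFun q := by
  have h0 : q ≠ 0 := by rintro rfl; simp [offRay] at hq
  have h1 := one_le_polarR h0
  have h2 := abs_le.1 (abs_fst_le_polarR q)
  have key : 1 / (2 * polarR q) ≤ polarR q - q.1 := by
    rw [div_le_iff₀ (by linarith)]
    by_cases hy : q.2 = 0
    · have hx : q.1 < 0 := by
        by_contra hx; exact hq ⟨hy, not_lt.1 hx⟩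
      have hx' : (q.1 : ℝ) < 0 := by exact_mod_cast hx
      nlinarith
    · have hy' : (1 : ℝ) ≤ (q.2 : ℝ) ^ 2 := by
        have : 0 < q.2 ^ 2 := by positivity
        exact_mod_cast this
      have := polarR_sq q
      nlinarith
  rw [tipFun_eq, div_le_div_iff₀ (by positivity) (by linarith)]
  have h5 : 1 / (2 * polarR q) ≤ Real.sqrt ((polarR q - q.1) / 2) := by
    refine Real.le_sqrt_of_sq_le ?_
    have : (1 / (2 * polarR q)) ^ 2 ≤ 1 / (2 * polarR q) * (1 / 2) := by
      rw [sq]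
      gcongr
      linarith
    linarith
  calc 1 * polarR q = 1 / (2 * polarR q) * (2 * polarR q ^ 2) := by field_simp
    _ ≤ _ := by gcongr

lemma tipFun_sum_increments_lt {q : ℤ × ℤ} (hq : q ∈ offRay) (hr : 10 ^ 6 ≤ polarR q) :
    3 * |∑ d ∈ unitSteps, (tipFun (q + d) - tipFun q)|
      < ∑ d ∈ unitSteps, (tipFun (q + d) - tipFun q) ^ 2 := by
  have e1 : negToComplex (1, 0) = -1 := by apply Complex.ext <;> simp [negToComplex]
  have e2 : negToComplex (-1, 0) = 1 := by apply Complex.ext <;> simp [negToComplex]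
  have e3 : negToComplex (0, 1) = -Complex.I := by apply Complex.ext <;> simp [negToComplex]
  have e4 : negToComplex (0, -1) = Complex.I := by apply Complex.ext <;> simp [negToComplex]
  have h := reInvSqrt_sum_increments_lt (z := negToComplex q)
    (by rwa [norm_negToComplex]) ?_
  · simp only [sum_unitSteps, tipFun, negToComplex_add, e1, e2, e3, e4]
    convert h using 1
    · congr 2; ring
    · ring
  · have him : ∀ d : ℂ, d = 1 ∨ d = -1 ∨ d = Complex.I ∨ d = -Complex.I →
        -1 ≤ d.im ∧ d.im ≤ 1 := by
      rintro d (rfl | rfl | rfl | rfl) <;> simp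
    intro d hd
    obtain ⟨i1, i2⟩ := him d hd
    rw [Complex.add_im]
    simp only [negToComplex]
    rcases lt_trichotomy q.2 0 with h | h | h
    · left
      have : (q.2 : ℝ) ≤ -1 := by exact_mod_cast (by omega : q.2 ≤ -1)
      constructor <;> linarith
    · right; right
      have hx : q.1 < 0 := by
        by_contra hx; exact hq ⟨h, not_lt.1 hx⟩
      have hx' : (q.1 : ℝ) < 0 := by exact_mod_cast hx
      constructor
      · simp [h]
      · linarith
    · right; left
      have : (1 : ℝ) ≤ q.2 := by exact_mod_cast (by omega : 1 ≤ q.2)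
      constructor <;> linarith

lemma tipFun_sub_sq_superharmonic {q : ℤ × ℤ} (hq : q ∈ offRay) (hr : 10 ^ 6 ≤ polarR q) :
    ∑ d ∈ unitSteps, (tipFun (q + d) - tipFun (q + d) ^ 2) ≤ 4 * (tipFun q - tipFun q ^ 2) := by
  have h0 : q ≠ 0 := by rintro rfl; simp [offRay] at hq
  have h := tipFun_sum_increments_lt hq hr
  have f0 := tipFun_nonneg q
  have f1 := tipFun_le_one h0
  rw [← sum_const_unitSteps, ← sub_nonpos, ← Finset.sum_sub_distrib]
  have : ∑ d ∈ unitSteps, (tipFun (q + d) - tipFun (q + d) ^ 2 - (tipFun q - tipFun q ^ 2))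
      = (1 - 2 * tipFun q) * ∑ d ∈ unitSteps, (tipFun (q + d) - tipFun q)
        - ∑ d ∈ unitSteps, (tipFun (q + d) - tipFun q) ^ 2 := by
    rw [Finset.mul_sum, ← Finset.sum_sub_distrib]
    exact Finset.sum_congr rfl fun d _ => by ring
  rw [this]
  set S := ∑ d ∈ unitSteps, (tipFun (q + d) - tipFun q)
  have h3 : (1 - 2 * tipFun q) * S ≤ 3 * |S| := by
    refine (le_abs_self _).trans ?_
    rw [abs_mul]
    refine mul_le_mul_of_nonneg_right ?_ (abs_nonneg S)
    exact abs_le.2 ⟨by linarith only [f0, f1], by linarith only [f0, f1]⟩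
  linarith only [h, h3]

lemma tipFun_add_sq_subharmonic {q : ℤ × ℤ} (hq : q ∈ offRay) (hr : 10 ^ 6 ≤ polarR q) :
    4 * (tipFun q + tipFun q ^ 2) < ∑ d ∈ unitSteps, (tipFun (q + d) + tipFun (q + d) ^ 2) := by
  have h0 : q ≠ 0 := by rintro rfl; simp [offRay] at hq
  have h := tipFun_sum_increments_lt hq hr
  have f0 := tipFun_nonneg q
  have f1 := tipFun_le_one h0
  rw [← sum_const_unitSteps, ← sub_pos, ← Finset.sum_sub_distrib]
  have : ∑ d ∈ unitSteps, (tipFun (q + d) + tipFun (q + d) ^ 2 - (tipFun q + tipFun q ^ 2))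
      = (1 + 2 * tipFun q) * ∑ d ∈ unitSteps, (tipFun (q + d) - tipFun q)
        + ∑ d ∈ unitSteps, (tipFun (q + d) - tipFun q) ^ 2 := by
    rw [Finset.mul_sum, ← Finset.sum_add_distrib]
    exact Finset.sum_congr rfl fun d _ => by ring
  rw [this]
  set S := ∑ d ∈ unitSteps, (tipFun (q + d) - tipFun q)
  have h3 : -((1 + 2 * tipFun q) * S) ≤ 3 * |S| := by
    refine (neg_le_abs _).trans ?_
    rw [abs_mul]
    refine mul_le_mul_of_nonneg_right ?_ (abs_nonneg S)
    exact abs_le.2 ⟨by linarith only [f0, f1], by linarith only [f0, f1]⟩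
  linarith only [h, h3]

/-- The probability that simple random walk from `p` reaches the origin within `n` steps,
staying in `A` up to that time. -/
def hitProb (A : Set (ℤ × ℤ)) : ℕ → ℤ × ℤ → ℝ
  | 0, p => if p = 0 then 1 else 0
  | n + 1, p => if p = 0 then 1 else
      if p ∈ A then (∑ d ∈ unitSteps, hitProb A n (p + d)) / 4 else 0

lemma hitProb_zero_right (A : Set (ℤ × ℤ)) (n : ℕ) : hitProb A n 0 = 1 := by
  cases n <;> simp [hitProb]

lemma hitProb_of_notMem {A : Set (ℤ × ℤ)} {p : ℤ × ℤ} (hp : p ≠ 0) (hA : p ∉ A) (n : ℕ) :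
    hitProb A n p = 0 := by
  cases n <;> simp [hitProb, hp, hA]

lemma hitProb_succ {A : Set (ℤ × ℤ)} {p : ℤ × ℤ} (hp : p ≠ 0) (hA : p ∈ A) (n : ℕ) :
    hitProb A (n + 1) p = (∑ d ∈ unitSteps, hitProb A n (p + d)) / 4 := by
  simp [hitProb, hp, hA]

lemma hitProb_nonneg (A : Set (ℤ × ℤ)) (n : ℕ) (p : ℤ × ℤ) : 0 ≤ hitProb A n p := by
  induction n generalizing p with
  | zero => simp only [hitProb]; split_ifs <;> norm_num
  | succ n ih =>
    simp only [hitProb]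
    split_ifs
    · norm_num
    · exact div_nonneg (Finset.sum_nonneg fun d _ => ih _) (by norm_num)
    · exact le_rfl

lemma hitProb_le_one (A : Set (ℤ × ℤ)) (n : ℕ) (p : ℤ × ℤ) : hitProb A n p ≤ 1 := by
  induction n generalizing p with
  | zero => simp only [hitProb]; split_ifs <;> norm_num
  | succ n ih =>
    simp only [hitProb]
    split_ifs
    · norm_num
    · have := Finset.sum_le_sum fun d (_ : d ∈ unitSteps) => ih (p + d)
      rw [sum_const_unitSteps] at this
      linarith
    · norm_num

lemma hitProb_mono_set {A B : Set (ℤ × ℤ)} (hAB : A ⊆ B) (n : ℕ) (p : ℤ × ℤ) :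
    hitProb A n p ≤ hitProb B n p := by
  induction n generalizing p with
  | zero => simp [hitProb]
  | succ n ih =>
    by_cases hp : p = 0
    · simp [hp, hitProb_zero_right]
    by_cases hA : p ∈ A
    · rw [hitProb_succ hp hA, hitProb_succ hp (hAB hA)]
      gcongr
      exact ih _
    · rw [hitProb_of_notMem hp hA]; exact hitProb_nonneg _ _ _

lemma hitProb_mono (A : Set (ℤ × ℤ)) (p : ℤ × ℤ) : Monotone fun n => hitProb A n p := by
  have : ∀ n p, hitProb A n p ≤ hitProb A (n + 1) p := by
    intro n
    induction n with
    | zero =>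
      intro p
      by_cases hp : p = 0
      · simp [hp, hitProb_zero_right]
      · rw [show hitProb A 0 p = 0 by simp [hitProb, hp]]; exact hitProb_nonneg _ _ _
    | succ n ih =>
      intro p
      by_cases hp : p = 0
      · simp [hp, hitProb_zero_right]
      by_cases hA : p ∈ A
      · rw [hitProb_succ hp hA, hitProb_succ hp hA]
        gcongr
        exact ih _
      · rw [hitProb_of_notMem hp hA, hitProb_of_notMem hp hA]
  exact monotone_nat_of_le_succ fun n => this n p

/-- The probability that simple random walk from `p` reaches the origin, staying in `A` up to
that time. -/
def hitProbLim (A : Set (ℤ × ℤ)) (p : ℤ × ℤ) : ℝ := ⨆ n, hitProb A n p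

lemma bddAbove_hitProb (A : Set (ℤ × ℤ)) (p : ℤ × ℤ) :
    BddAbove (Set.range fun n => hitProb A n p) :=
  ⟨1, by rintro _ ⟨n, rfl⟩; exact hitProb_le_one _ _ _⟩

lemma hitProb_le_lim (A : Set (ℤ × ℤ)) (n : ℕ) (p : ℤ × ℤ) : hitProb A n p ≤ hitProbLim A p :=
  le_ciSup (bddAbove_hitProb A p) n

lemma tendsto_hitProb (A : Set (ℤ × ℤ)) (p : ℤ × ℤ) :
    Filter.Tendsto (fun n => hitProb A n p) Filter.atTop (nhds (hitProbLim A p)) :=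
  tendsto_atTop_ciSup (hitProb_mono A p) (bddAbove_hitProb A p)

lemma hitProbLim_nonneg (A : Set (ℤ × ℤ)) (p : ℤ × ℤ) : 0 ≤ hitProbLim A p :=
  (hitProb_nonneg A 0 p).trans (hitProb_le_lim A 0 p)

lemma sum_hitProbLim {A : Set (ℤ × ℤ)} {p : ℤ × ℤ} (hp : p ≠ 0) (hA : p ∈ A) :
    ∑ d ∈ unitSteps, hitProbLim A (p + d) = 4 * hitProbLim A p := by
  have h1 : Filter.Tendsto (fun n => ∑ d ∈ unitSteps, hitProb A n (p + d)) Filter.atTop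
      (nhds (∑ d ∈ unitSteps, hitProbLim A (p + d))) :=
    tendsto_finsetSum _ fun d _ => tendsto_hitProb A (p + d)
  have h2 := ((tendsto_hitProb A p).comp (Filter.tendsto_add_atTop_nat 1)).const_mul 4
  refine tendsto_nhds_unique h1 (h2.congr fun n => ?_)
  simp only [Function.comp_apply, hitProb_succ hp hA]
  ring

lemma hitProb_le_add {A B : Set (ℤ × ℤ)} {M : ℝ} (hM : 0 ≤ M)
    (h : ∀ n, ∀ q ∈ A, q ∉ B → hitProb A n q ≤ M) (n : ℕ) (p : ℤ × ℤ) :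
    hitProb A n p ≤ hitProb B n p + M := by
  induction n generalizing p with
  | zero => simp [hitProb, hM]
  | succ n ih =>
    by_cases hp : p = 0
    · simp [hp, hitProb_zero_right, hM]
    by_cases hA : p ∈ A
    · by_cases hB : p ∈ B
      · rw [hitProb_succ hp hA, hitProb_succ hp hB]
        have := Finset.sum_le_sum fun d (_ : d ∈ unitSteps) => ih (p + d)
        rw [Finset.sum_add_distrib, sum_const_unitSteps] at this
        linarith
      · exact (h _ _ hA hB).trans (le_add_of_nonneg_left (hitProb_nonneg _ _ _))
    · rw [hitProb_of_notMem hp hA]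
      exact add_nonneg (hitProb_nonneg _ _ _) hM

lemma zero_notMem_offRay : (0 : ℤ × ℤ) ∉ offRay := by simp [offRay]

lemma ne_zero_of_mem_offRay {q : ℤ × ℤ} (hq : q ∈ offRay) : q ≠ 0 := by
  rintro rfl; exact zero_notMem_offRay hq

/-- Upper bound for the probability of hitting the ray at the tip. -/
lemma exists_hitProb_offRay_le : ∃ C : ℝ, 0 < C ∧ ∀ (n : ℕ) (q : ℤ × ℤ), q ≠ 0 →
    hitProb offRay n q ≤ C / Real.sqrt (polarR q) := by
  set V : ℤ × ℤ → ℝ := fun q => tipFun q - tipFun q ^ 2 with hV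
  have hT : ∀ q : ℤ × ℤ, 10 ^ 6 - 1 ≤ polarR q → q ≠ 0 ∧ tipFun q ≤ 1 / 2 := by
    intro q hq
    have h0 : q ≠ 0 := by
      rintro rfl
      rw [polarR] at hq; norm_num at hq
    refine ⟨h0, (tipFun_le h0).trans ?_⟩
    have : 2 ≤ Real.sqrt (polarR q) := Real.le_sqrt_of_sq_le (by linarith)
    exact one_div_le_one_div_of_le (by norm_num) this
  have hV2 : ∀ q : ℤ × ℤ, 10 ^ 6 - 1 ≤ polarR q → tipFun q / 2 ≤ V q := by
    intro q hq
    have h1 := (hT q hq).2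
    have h2 := tipFun_nonneg q
    simp only [hV]; nlinarith
  have key : ∀ (n : ℕ) (q : ℤ × ℤ), 10 ^ 6 - 1 ≤ polarR q →
      hitProb offRay n q ≤ (4 * 10 ^ 12) * V q := by
    intro n
    induction n with
    | zero =>
      intro q hq
      rw [show hitProb offRay 0 q = 0 by simp [hitProb, (hT q hq).1]]
      have := hV2 q hq
      have := tipFun_nonneg q
      linarith
    | succ n ih =>
      intro q hq
      by_cases hA : q ∈ offRay
      · rcases lt_or_ge (polarR q) (10 ^ 6) with hr | hr
        · refine (hitProb_le_one _ _ _).trans ?_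
          have h1 := le_tipFun_of_mem_offRay hA
          have h2 : 1 / (2 * (10 ^ 6) ^ 2) ≤ 1 / (2 * polarR q ^ 2) := by
            have : 0 < polarR q := by linarith
            gcongr
          have := hV2 q hq
          linarith
        · rw [hitProb_succ (hT q hq).1 hA]
          have h1 := tipFun_sub_sq_superharmonic hA hr
          have h2 : ∑ d ∈ unitSteps, hitProb offRay n (q + d)
              ≤ ∑ d ∈ unitSteps, (4 * 10 ^ 12) * V (q + d) := by
            refine Finset.sum_le_sum fun d hd => ?_
            exact ih _ (by linarith [polarR_add_step_ge q hd])
          rw [← Finset.mul_sum] at h2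
          simp only [hV] at h2 ⊢
          linarith
      · rw [hitProb_of_notMem (hT q hq).1 hA]
        have := hV2 q hq
        have := tipFun_nonneg q
        linarith
  refine ⟨4 * 10 ^ 12, by norm_num, fun n q hq => ?_⟩
  have h1 := one_le_polarR hq
  have h2 : 0 < Real.sqrt (polarR q) := Real.sqrt_pos.2 (by linarith)
  rcases le_or_gt (10 ^ 6 - 1) (polarR q) with hr | hr
  · refine (key n q hr).trans ?_
    have h3 := tipFun_le hq
    have h4 : V q ≤ 1 / Real.sqrt (polarR q) :=
      (sub_le_self _ (sq_nonneg _)).trans h3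
    calc _ ≤ 4 * 10 ^ 12 * (1 / Real.sqrt (polarR q)) := by gcongr
      _ = _ := by ring
  · refine (hitProb_le_one _ _ _).trans ?_
    rw [le_div_iff₀ h2, one_mul]
    refine (Real.sqrt_le_left (by norm_num)).2 ?_
    linarith

/-- The part of the complement of the ray inside the disk of radius `r`. -/
def offRayDisk (r : ℝ) : Set (ℤ × ℤ) := {q | q ∈ offRay ∧ polarR q ≤ r}

lemma offRayDisk_mono {r r' : ℝ} (h : r ≤ r') : offRayDisk r ⊆ offRayDisk r' :=
  fun _ hq => ⟨hq.1, hq.2.trans h⟩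

lemma exists_hitProb_pos_of_step {q d : ℤ × ℤ} (hd : d ∈ unitSteps) (hq : q ∈ offRay)
    (h : ∃ k : ℕ, 0 < hitProb (offRayDisk k) k (q + d)) :
    ∃ k : ℕ, 0 < hitProb (offRayDisk k) k q := by
  obtain ⟨k, hk⟩ := h
  obtain ⟨m, hm⟩ := exists_nat_ge (polarR q)
  refine ⟨max k m + 1, ?_⟩
  have hmem : q ∈ offRayDisk ((max k m + 1 : ℕ) : ℝ) := by
    refine ⟨hq, hm.trans ?_⟩
    exact_mod_cast (le_max_right k m).trans (Nat.le_succ _)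
  rw [hitProb_succ (ne_zero_of_mem_offRay hq) hmem]
  refine div_pos (Finset.sum_pos' (fun d _ => hitProb_nonneg _ _ _) ⟨d, hd, ?_⟩) (by norm_num)
  refine hk.trans_le ((hitProb_mono _ _ (le_max_left k m)).trans (hitProb_mono_set ?_ _ _))
  refine offRayDisk_mono ?_
  exact_mod_cast (le_max_left k m).trans (Nat.le_succ _)

lemma exists_hitProb_pos {q : ℤ × ℤ} (hq : q ∈ offRay) :
    ∃ k : ℕ, 0 < hitProb (offRayDisk k) k q := by
  have left : ∀ m : ℕ, ∃ k : ℕ, 0 < hitProb (offRayDisk k) k (-(m : ℤ), 0) := by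
    intro m
    induction m with
    | zero =>
      refine ⟨0, ?_⟩
      have : ((-((0 : ℕ) : ℤ), 0) : ℤ × ℤ) = 0 := rfl
      rw [this, hitProb_zero_right]; norm_num
    | succ m ih =>
      refine exists_hitProb_pos_of_step (d := (1, 0)) (by simp [unitSteps]) ?_ ?_
      · simp only [offRay, Set.mem_ofPred_eq]; push_cast; omega
      · have : ((-((m + 1 : ℕ) : ℤ), 0) + (1, 0) : ℤ × ℤ) = (-(m : ℤ), 0) := by ext <;> simp
        rwa [this]
  have vert : ∀ (x : ℤ), x < 0 → ∀ (m : ℕ) (y : ℤ), y.natAbs = m →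
      ∃ k : ℕ, 0 < hitProb (offRayDisk k) k (x, y) := by
    intro x hx m
    induction m with
    | zero =>
      intro y hy
      obtain rfl : y = 0 := by omega
      have := left x.natAbs
      rwa [show -(x.natAbs : ℤ) = x by omega] at this
    | succ m ih =>
      intro y hy
      have hA : (x, y) ∈ offRay := by simp only [offRay, Set.mem_ofPred_eq]; omega
      rcases lt_or_ge y 0 with h | h
      · refine exists_hitProb_pos_of_step (d := (0, 1)) (by simp [unitSteps]) hA ?_
        simpa using ih (y + 1) (by omega)
      · refine exists_hitProb_pos_of_step (d := (0, -1)) (by simp [unitSteps]) hA ?_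
        simpa using ih (y + -1) (by omega)
  have horiz : ∀ (m : ℕ) (x y : ℤ), y ≠ 0 → x < m →
      ∃ k : ℕ, 0 < hitProb (offRayDisk k) k (x, y) := by
    intro m
    induction m with
    | zero => intro x y _ hx; exact vert x (by simpa using hx) _ y rfl
    | succ m ih =>
      intro x y hy hx
      have hA : (x, y) ∈ offRay := by simp [offRay, hy]
      refine exists_hitProb_pos_of_step (d := (-1, 0)) (by simp [unitSteps]) hA ?_
      simpa using ih (x + -1) y hy (by push_cast at hx; omega)
  obtain ⟨x, y⟩ := q
  by_cases hy : y = 0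
  · refine vert x ?_ _ y rfl
    by_contra hx
    exact hq ⟨hy, not_lt.1 hx⟩
  · exact horiz (x.toNat + 1) x y hy (by omega)

lemma exists_uniform_hitProb_lower (r : ℝ) : ∃ (k : ℕ) (δ : ℝ), 0 < δ ∧
    ∀ q ∈ offRay, polarR q ≤ r → δ ≤ hitProb (offRayDisk k) k q := by
  have h : ∀ q ∈ {q : ℤ × ℤ | polarR q ≤ r}, ∀ᶠ k : ℕ in Filter.atTop,
      q ∈ offRay → 0 < hitProb (offRayDisk k) k q := by
    intro q _
    by_cases hq : q ∈ offRay
    · obtain ⟨k, hk⟩ := exists_hitProb_pos hq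
      filter_upwards [Filter.eventually_ge_atTop k] with m hm _
      exact hk.trans_le ((hitProb_mono _ _ hm).trans
        (hitProb_mono_set (offRayDisk_mono (by exact_mod_cast hm)) _ _))
    · exact Filter.Eventually.of_forall fun _ h => absurd h hq
  obtain ⟨k, hk⟩ := ((Set.Finite.eventually_all (finite_polarR_le r)).2 h).exists
  have hfin : (offRayDisk r).Finite := (finite_polarR_le r).subset fun q hq => hq.2
  rcases (offRayDisk r).eq_empty_or_nonempty with he | hne
  · refine ⟨k, 1, one_pos, fun q hq hr => ?_⟩
    have : q ∈ offRayDisk r := ⟨hq, hr⟩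
    rw [he] at this; exact absurd this (Set.notMem_empty q)
  · obtain ⟨q0, hq0, hmin⟩ := Set.exists_min_image _ (fun q => hitProb (offRayDisk k) k q) hfin hne
    exact ⟨k, _, hk q0 hq0.2 hq0.1, fun q hq hr => hmin q ⟨hq, hr⟩⟩

/-- Comparison with the subharmonic function built from `tipFun`, on a finite disk. -/
lemma hitProbLim_offRayDisk_ge {δ R : ℝ} (hδ : 0 < δ) (hR : 1 ≤ R)
    (h : ∀ q ∈ offRay, polarR q ≤ 10 ^ 6 → δ ≤ hitProbLim (offRayDisk R) q)
    {p : ℤ × ℤ} (hp : p ∈ offRayDisk R) (hp2 : 10 ^ 6 < polarR p) :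
    δ / 2 * (tipFun p + tipFun p ^ 2 - 2 / Real.sqrt R) ≤ hitProbLim (offRayDisk R) p := by
  set W : ℤ × ℤ → ℝ := fun q => tipFun q + tipFun q ^ 2 with hW
  set H := hitProbLim (offRayDisk R) with hH
  set g : ℤ × ℤ → ℝ := fun q => δ / 2 * (W q - 2 / Real.sqrt R) - H q with hg
  set S : Set (ℤ × ℤ) := {q | q ∈ offRayDisk R ∧ 10 ^ 6 < polarR q} with hS
  have hRs : 0 < Real.sqrt R := Real.sqrt_pos.2 (by linarith)
  have hfin : S.Finite := (finite_polarR_le R).subset fun q hq => hq.1.2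
  obtain ⟨q, hq, hmax⟩ := Set.exists_max_image S g hfin ⟨p, hp, hp2⟩
  by_contra! hcon
  have hpos : 0 < g q := lt_of_lt_of_le (by simp only [hg]; linarith) (hmax p ⟨hp, hp2⟩)
  have hbd : ∀ q' : ℤ × ℤ, g q' ≤ g q := by
    intro q'
    by_cases hS' : q' ∈ S
    · exact hmax q' hS'
    refine le_trans ?_ hpos.le
    have hH0 : 0 ≤ H q' := hitProbLim_nonneg _ _
    have hc : 0 < 2 / Real.sqrt R := by positivity
    by_cases hA : q' ∈ offRay
    · have h0 := ne_zero_of_mem_offRay hA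
      have hW2 : W q' ≤ 2 * tipFun q' := by
        have := tipFun_le_one h0
        have := tipFun_nonneg q'
        simp only [hW]; nlinarith
      rcases le_or_gt (polarR q') (10 ^ 6) with hr | hr
      · have h1 := h q' hA hr
        have h2 := tipFun_le_one h0
        simp only [hg]
        nlinarith
      · have hr2 : R < polarR q' := by
          by_contra! hle
          exact hS' ⟨⟨hA, hle⟩, hr⟩
        have h1 : tipFun q' ≤ 1 / Real.sqrt R := (tipFun_le h0).trans
          (one_div_le_one_div_of_le hRs (Real.sqrt_le_sqrt hr2.le))
        have h2 : W q' - 2 / Real.sqrt R ≤ 0 := by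
          rw [show 2 / Real.sqrt R = 2 * (1 / Real.sqrt R) by ring]; linarith
        simp only [hg]
        nlinarith
    · have hW0 : W q' = 0 := by simp [hW, tipFun_eq_zero hA]
      simp only [hg, hW0]
      nlinarith
  have h1 : ∑ d ∈ unitSteps, g (q + d) ≤ 4 * g q := by
    rw [← sum_const_unitSteps]
    exact Finset.sum_le_sum fun d _ => hbd _
  have h2 := tipFun_add_sq_subharmonic hq.1.1 hq.2.le
  have h3 := sum_hitProbLim (ne_zero_of_mem_offRay hq.1.1) hq.1
  simp only [hg, hW, Finset.sum_sub_distrib, ← Finset.mul_sum, sum_const_unitSteps] at h1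
  rw [← hH] at h3
  rw [h3] at h1
  nlinarith

lemma mem_offRay_of_fst_neg {p : ℤ × ℤ} (hp : p.1 < 0) : p ∈ offRay := by
  simp only [offRay, Set.mem_ofPred_eq]; omega

/-- Both bounds of the theorem, in terms of the hitting probabilities `hitProb`. -/
lemma exists_hitProb_bounds : ∃ K c : ℝ, 1 < K ∧ 0 < c ∧ ∀ p : ℤ × ℤ, p.1 < 0 →
    c / Real.sqrt (polarR p) ≤ hitProbLim (offRayDisk (K * polarR p)) p ∧
    hitProbLim offRay p ≤ 2 * hitProbLim (offRayDisk (K * polarR p)) p := by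
  obtain ⟨C, hC, hup⟩ := exists_hitProb_offRay_le
  obtain ⟨k, δ, hδ, hlow⟩ := exists_uniform_hitProb_lower (10 ^ 6)
  set K : ℝ := max 100 (max k ((4 * C / δ) ^ 2)) with hK
  have hK1 : 100 ≤ K := le_max_left _ _
  have hK2 : (k : ℝ) ≤ K := (le_max_left _ _).trans (le_max_right _ _)
  have hK3 : (4 * C / δ) ^ 2 ≤ K := (le_max_right _ _).trans (le_max_right _ _)
  refine ⟨K, δ / 4, by linarith, by positivity, fun p hp => ?_⟩
  have hA := mem_offRay_of_fst_neg hp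
  have h0 := ne_zero_of_mem_offRay hA
  have hρ := one_le_polarR h0
  set ρ := polarR p with hρdef
  have hsρ : 1 ≤ Real.sqrt ρ := Real.one_le_sqrt.2 hρ
  have hR : K ≤ K * ρ := le_mul_of_one_le_right (by linarith) hρ
  have hsR : Real.sqrt (K * ρ) = Real.sqrt K * Real.sqrt ρ := Real.sqrt_mul (by linarith) _
  have hlow' : ∀ q ∈ offRay, polarR q ≤ 10 ^ 6 → δ ≤ hitProbLim (offRayDisk (K * ρ)) q :=
    fun q hq hr => (hlow q hq hr).trans
      ((hitProb_mono_set (offRayDisk_mono (hK2.trans hR)) _ _).trans (hitProb_le_lim _ _ _))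
  have first : δ / 4 / Real.sqrt ρ ≤ hitProbLim (offRayDisk (K * ρ)) p := by
    rcases le_or_gt ρ (10 ^ 6) with hr | hr
    · refine le_trans ?_ (hlow' p hA hr)
      rw [div_le_iff₀ (by linarith)]
      nlinarith
    · refine le_trans ?_ (hitProbLim_offRayDisk_ge hδ (by linarith) hlow'
        ⟨hA, by rw [← hρdef]; nlinarith⟩ hr)
      have h1 := le_tipFun_of_fst_neg hp
      rw [← hρdef] at h1
      have h2 : 10 ≤ Real.sqrt K := Real.le_sqrt_of_sq_le (by linarith)
      have h3 : 2 / Real.sqrt (K * ρ) ≤ 1 / 5 / Real.sqrt ρ := by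
        rw [hsR, div_le_div_iff₀ (by positivity) (by linarith)]
        nlinarith
      have h4 : 1 / 2 / Real.sqrt ρ = 7 / 10 / Real.sqrt ρ - 1 / 5 / Real.sqrt ρ := by ring
      calc δ / 4 / Real.sqrt ρ = δ / 2 * (1 / 2 / Real.sqrt ρ) := by ring
        _ ≤ _ := by
          gcongr
          linarith [sq_nonneg (tipFun p)]
  refine ⟨first, ?_⟩
  have hM : C / Real.sqrt (K * ρ) ≤ δ / 4 / Real.sqrt ρ := by
    have h2 : 4 * C / δ ≤ Real.sqrt K := Real.le_sqrt_of_sq_le hK3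
    rw [div_le_iff₀ hδ] at h2
    rw [hsR, div_le_div_iff₀ (mul_pos (Real.sqrt_pos.2 (by linarith)) (by linarith)) (by linarith)]
    nlinarith
  refine ciSup_le fun n => ?_
  have h5 := hitProb_le_add (A := offRay) (B := offRayDisk (K * ρ))
    (M := C / Real.sqrt (K * ρ)) (by positivity) ?_ n p
  · have := hitProb_le_lim (offRayDisk (K * ρ)) n p
    linarith
  · intro n q hq hqB
    have hlt : K * ρ < polarR q := by
      by_contra! hle
      exact hqB ⟨hq, hle⟩
    refine (hup n q (ne_zero_of_mem_offRay hq)).trans ?_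
    have : 0 < Real.sqrt (K * ρ) := Real.sqrt_pos.2 (by linarith)
    gcongr

lemma erw2StepProb_zero (first : Prop) (d : ℤ × ℤ) :
    erw2StepProb 0 first d = if d ∈ unitSteps then 1 / 4 else 0 := by
  by_cases h1 : d = (1, 0)
  · simp [erw2StepProb, unitSteps, h1]
  by_cases h2 : d = (-1, 0)
  · simp [erw2StepProb, unitSteps, h2]
  by_cases h3 : d = (0, 1) ∨ d = (0, -1)
  · simp [erw2StepProb, unitSteps, h1, h2, h3]
  · simp only [erw2StepProb, unitSteps, Finset.mem_insert, Finset.mem_singleton, h1, h2, h3,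
      if_false, false_or]

section Walk

variable {Ω : Type*} {X : ℕ → Ω → ℤ × ℤ}

/-- The event that, from time `n` on, the walk reaches the origin within `N` steps, staying in
`A` before that. -/
def hitEvent (X : ℕ → Ω → ℤ × ℤ) (A : Set (ℤ × ℤ)) (n N : ℕ) : Set Ω :=
  {ω | ∃ m ≤ N, X (n + m) ω = 0 ∧ ∀ k < m, X (n + k) ω ∈ A}

/-- The event that the walk agrees with `h` up to time `n`. -/
def historyEvent (X : ℕ → Ω → ℤ × ℤ) (h : ℕ → ℤ × ℤ) (n : ℕ) : Set Ω :=
  {ω | ∀ k ≤ n, X k ω = h k}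

lemma hitEvent_succ_inter_history {A : Set (ℤ × ℤ)} {h : ℕ → ℤ × ℤ} {n : ℕ} (N : ℕ)
    (h0 : h n ≠ 0) (hA : h n ∈ A) (s : ℤ × ℤ) :
    hitEvent X A n (N + 1) ∩ historyEvent X h n ∩ {ω | X (n + 1) ω = h n + s}
      = hitEvent X A (n + 1) N ∩ historyEvent X (Function.update h (n + 1) (h n + s)) (n + 1) := by
  ext ω
  simp only [hitEvent, historyEvent, Set.mem_inter_iff, Set.mem_ofPred_eq]
  have hist : (∀ k ≤ n + 1, X k ω = Function.update h (n + 1) (h n + s) k) ↔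
      (∀ k ≤ n, X k ω = h k) ∧ X (n + 1) ω = h n + s := by
    constructor
    · intro H
      refine ⟨fun k hk => ?_, by simpa using H (n + 1) le_rfl⟩
      have := H k (by omega)
      rwa [Function.update_of_ne (by omega)] at this
    · rintro ⟨H1, H2⟩ k hk
      rcases Nat.lt_or_ge n k with hlt | hle
      · obtain rfl : k = n + 1 := by omega
        simpa using H2
      · rw [Function.update_of_ne (by omega)]; exact H1 k hle
  rw [hist]
  constructor
  · rintro ⟨⟨⟨m, hm, hX, hAk⟩, H1⟩, H2⟩
    refine ⟨?_, H1, H2⟩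
    cases m with
    | zero => exact absurd ((H1 n le_rfl).symm.trans hX) h0
    | succ m =>
      refine ⟨m, by omega, by rw [← hX]; congr 1; omega, fun k hk => ?_⟩
      have := hAk (k + 1) (by omega)
      rwa [show n + (k + 1) = n + 1 + k by omega] at this
  · rintro ⟨⟨m, hm, hX, hAk⟩, H1, H2⟩
    refine ⟨⟨⟨m + 1, by omega, by rw [← hX]; congr 1; omega, fun k hk => ?_⟩, H1⟩, H2⟩
    cases k with
    | zero => rw [add_zero, H1 n le_rfl]; exact hA
    | succ k =>
      have := hAk k (by omega)
      rwa [show n + 1 + k = n + (k + 1) by omega] at this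

variable [MeasurableSpace Ω] {P : Measure Ω} {p : ℤ × ℤ}

lemma IsERW2.sub_const (hX : IsSRW2 p P X) (v : ℤ × ℤ) :
    IsSRW2 (p - v) P (fun n ω => X n ω - v) where
  isProb := hX.isProb
  meas n := (hX.meas n).sub_const v
  start := by filter_upwards [hX.start] with ω h; rw [h]
  step n h s := by
    have := hX.step n (fun k => h k + v) s
    simp only [erw2StepProb_zero] at this ⊢
    convert this using 4
    · ext ω; simp only [sub_eq_iff_eq_add]
      rw [add_right_comm]
    · ext ω; simp only [sub_eq_iff_eq_add]
    · ext ω; simp only [sub_eq_iff_eq_add]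

lemma measure_historyEvent_succ (hX : IsSRW2 p P X) (h : ℕ → ℤ × ℤ) (n : ℕ) (s : ℤ × ℤ) :
    P (historyEvent X (Function.update h (n + 1) (h n + s)) (n + 1))
      = ENNReal.ofReal (if s ∈ unitSteps then 1 / 4 else 0) * P (historyEvent X h n) := by
  have := hX.step n h s
  rw [erw2StepProb_zero] at this
  rw [historyEvent, historyEvent, ← this]
  congr 1
  ext ω
  simp only [Set.mem_inter_iff, Set.mem_ofPred_eq]
  constructor
  · intro H
    refine ⟨by simpa using H (n + 1) le_rfl, fun k hk => ?_⟩
    have := H k (by omega)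
    rwa [Function.update_of_ne (by omega)] at this
  · rintro ⟨H2, H1⟩ k hk
    rcases Nat.lt_or_ge n k with hlt | hle
    · obtain rfl : k = n + 1 := by omega
      simpa using H2
    · rw [Function.update_of_ne (by omega)]; exact H1 k hle

lemma measure_eq_tsum_step (hX : IsSRW2 p P X) (B : Set Ω) (n : ℕ) (a : ℤ × ℤ) :
    P B = ∑' s, P (B ∩ {ω | X (n + 1) ω = a + s}) := by
  have hm : ∀ s, MeasurableSet {ω | X (n + 1) ω = a + s} := fun s =>
    hX.meas (n + 1) (measurableSet_singleton (a + s))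
  have h1 := measure_iUnion₀ (μ := P.restrict B) (f := fun s => {ω | X (n + 1) ω = a + s}) ?_
    fun s => (hm s).nullMeasurableSet
  · have hU : (⋃ s, {ω | X (n + 1) ω = a + s}) = Set.univ := by
      refine Set.eq_univ_of_forall fun ω => Set.mem_iUnion.2 ⟨X (n + 1) ω - a, ?_⟩
      simp
    rw [hU, Measure.restrict_apply_univ] at h1
    rw [h1]
    refine tsum_congr fun s => ?_
    rw [Measure.restrict_apply (hm s), Set.inter_comm]
  · intro s t hst
    refine Disjoint.aedisjoint (Set.disjoint_left.2 fun ω hs ht => hst ?_)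
    simp only [Set.mem_ofPred_eq] at hs ht
    exact add_left_cancel (hs.symm.trans ht)

lemma measure_hitEvent_inter_history (hX : IsSRW2 p P X) {A : Set (ℤ × ℤ)} (N n : ℕ)
    (h : ℕ → ℤ × ℤ) : P (hitEvent X A n N ∩ historyEvent X h n)
      = ENNReal.ofReal (hitProb A N (h n)) * P (historyEvent X h n) := by
  induction N generalizing n h with
  | zero =>
    by_cases h0 : h n = 0
    · rw [h0, hitProb_zero_right, ENNReal.ofReal_one, one_mul]
      congr 1
      refine Set.inter_eq_right.2 fun ω hω => ⟨0, le_rfl, ?_, by simp⟩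
      rw [add_zero, hω n le_rfl, h0]
    · simp only [hitProb, h0, if_false, ENNReal.ofReal_zero, zero_mul]
      rw [← measure_empty (μ := P)]
      congr 1
      refine Set.eq_empty_of_forall_notMem ?_
      rintro ω ⟨⟨m, hm, hX0, -⟩, hω⟩
      obtain rfl : m = 0 := by omega
      exact h0 ((hω n le_rfl).symm.trans hX0)
  | succ N ih =>
    by_cases h0 : h n = 0
    · rw [h0, hitProb_zero_right, ENNReal.ofReal_one, one_mul]
      congr 1
      refine Set.inter_eq_right.2 fun ω hω => ⟨0, by omega, ?_, by simp⟩
      rw [add_zero, hω n le_rfl, h0]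
    by_cases hA : h n ∈ A
    · rw [measure_eq_tsum_step hX _ n (h n)]
      have hterm : ∀ s, P (hitEvent X A n (N + 1) ∩ historyEvent X h n
          ∩ {ω | X (n + 1) ω = h n + s}) = ENNReal.ofReal (hitProb A N (h n + s))
            * (ENNReal.ofReal (if s ∈ unitSteps then 1 / 4 else 0) * P (historyEvent X h n)) := by
        intro s
        rw [hitEvent_succ_inter_history N h0 hA, ih, measure_historyEvent_succ hX,
          Function.update_self]
      simp only [hterm]
      rw [tsum_eq_sum (s := unitSteps) (by intro s hs; simp [hs]), hitProb_succ h0 hA,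
        Finset.sum_div, ENNReal.ofReal_sum_of_nonneg
          (fun d _ => div_nonneg (hitProb_nonneg _ _ _) (by norm_num)), Finset.sum_mul]
      refine Finset.sum_congr rfl fun d hd => ?_
      rw [if_pos hd, ← mul_assoc, ← ENNReal.ofReal_mul (hitProb_nonneg _ _ _)]
      congr 2
      ring
    · rw [hitProb_of_notMem h0 hA, ENNReal.ofReal_zero, zero_mul, ← measure_empty (μ := P)]
      congr 1
      refine Set.eq_empty_of_forall_notMem ?_
      rintro ω ⟨⟨m, hm, hX0, hk⟩, hω⟩
      rcases Nat.eq_zero_or_pos m with rfl | hm0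
      · exact h0 ((hω n le_rfl).symm.trans hX0)
      · apply hA
        rw [← hω n le_rfl]
        exact hk 0 hm0

lemma measure_hitEvent (hX : IsSRW2 p P X) (A : Set (ℤ × ℤ)) (N : ℕ) :
    P (hitEvent X A 0 N) = ENNReal.ofReal (hitProb A N p) := by
  have := hX.isProb
  have hh : ∀ᵐ ω ∂P, ω ∈ historyEvent X (fun _ => p) 0 := by
    filter_upwards [hX.start] with ω hω k hk
    obtain rfl : k = 0 := by omega
    exact hω
  have h1 := measure_hitEvent_inter_history hX (A := A) N 0 (fun _ => p)
  have h2 : P (historyEvent X (fun _ => p) 0) = 1 :=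
    (measure_congr (Filter.eventuallyEq_univ.2 hh)).trans measure_univ
  rw [h2, mul_one] at h1
  rw [← h1]
  refine measure_congr ?_
  filter_upwards [hh] with ω hω
  exact propext ⟨fun h => ⟨h, hω⟩, fun h => h.1⟩

/-- Simple random walk from `p` reaches the origin through `A` with probability
`hitProbLim A p`. -/
lemma measure_exists_hit (hX : IsSRW2 p P X) (A : Set (ℤ × ℤ)) :
    P {ω | ∃ n, X n ω = 0 ∧ ∀ k < n, X k ω ∈ A} = ENNReal.ofReal (hitProbLim A p) := by
  have hU : {ω | ∃ n, X n ω = 0 ∧ ∀ k < n, X k ω ∈ A} = ⋃ N, hitEvent X A 0 N := by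
    ext ω
    simp only [hitEvent, zero_add, Set.mem_iUnion, Set.mem_ofPred_eq]
    exact ⟨fun ⟨n, h⟩ => ⟨n, n, le_rfl, h⟩, fun ⟨_, n, _, h⟩ => ⟨n, h⟩⟩
  have hmono : Monotone fun N => hitEvent X A 0 N :=
    fun _ _ hab _ ⟨m, hm, h⟩ => ⟨m, hm.trans hab, h⟩
  rw [hU]
  refine tendsto_nhds_unique (tendsto_measure_iUnion_atTop hmono) ?_
  refine ((ENNReal.continuous_ofReal.tendsto _).comp (tendsto_hitProb A p)).congr fun N => ?_
  simp only [Function.comp_apply, measure_hitEvent hX]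

end Walk

/-- **Hitting a ray at its tip without leaving a disk.**
There are constants `K > 1` and `c > 0` such that for any tip `v = (x,y) ∈ ℤ²`
and any point `p` with `p.1 < v.1`, at distance `ρ = |p - v|` from `v`, the
probability that simple random walk started at `p` first hits the ray
`{(x', y) : x' ≥ x}` at the tip `v`, while staying inside the disk of radius
`K·ρ` around `v`, is at least `c·ρ^{-1/2}`; equivalently, it is at least half
of the unrestricted probability of first hitting the ray at the tip. -/
theorem srw_hits_ray_at_tip_before_leaving_disk :
    ∃ K c : ℝ, 1 < K ∧ 0 < c ∧
      ∀ (v p : ℤ × ℤ), p.1 < v.1 →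
        ∀ (Ω : Type) [MeasurableSpace Ω] (P : Measure Ω) (X : ℕ → Ω → ℤ × ℤ),
          IsSRW2 p P X →
          ENNReal.ofReal (c / Real.sqrt (polarR (p - v))) ≤
              P {ω | ∃ n, X n ω = v ∧
                  (∀ k < n, ¬((X k ω).2 = v.2 ∧ v.1 ≤ (X k ω).1)) ∧
                  ∀ k ≤ n, polarR (X k ω - v) ≤ K * polarR (p - v)} ∧
            P {ω | ∃ n, X n ω = v ∧
                  ∀ k < n, ¬((X k ω).2 = v.2 ∧ v.1 ≤ (X k ω).1)} ≤
              2 * P {ω | ∃ n, X n ω = v ∧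
                  (∀ k < n, ¬((X k ω).2 = v.2 ∧ v.1 ≤ (X k ω).1)) ∧
                  ∀ k ≤ n, polarR (X k ω - v) ≤ K * polarR (p - v)} := by
  obtain ⟨K, c, hK, hc, hbound⟩ := exists_hitProb_bounds
  refine ⟨K, c, hK, hc, ?_⟩
  intro v p hpv Ω _ P X hX
  obtain ⟨h1, h2⟩ := hbound (p - v) (by simpa using hpv)
  have hY := hX.sub_const v
  have hray : ∀ q : ℤ × ℤ, ¬(q.2 = v.2 ∧ v.1 ≤ q.1) ↔ q - v ∈ offRay := by
    intro q
    simp only [offRay, Set.mem_ofPred_eq, Prod.fst_sub, Prod.snd_sub, sub_eq_zero, sub_nonneg]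
  have hfull := measure_exists_hit hY offRay
  have hdisk := measure_exists_hit hY (offRayDisk (K * polarR (p - v)))
  have e1 : {ω | ∃ n, X n ω = v ∧ ∀ k < n, ¬((X k ω).2 = v.2 ∧ v.1 ≤ (X k ω).1)}
      = {ω | ∃ n, X n ω - v = 0 ∧ ∀ k < n, X k ω - v ∈ offRay} := by
    simp only [hray, sub_eq_zero]
  have e2 : {ω | ∃ n, X n ω = v ∧ (∀ k < n, ¬((X k ω).2 = v.2 ∧ v.1 ≤ (X k ω).1)) ∧
        ∀ k ≤ n, polarR (X k ω - v) ≤ K * polarR (p - v)}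
      = {ω | ∃ n, X n ω - v = 0 ∧
        ∀ k < n, X k ω - v ∈ offRayDisk (K * polarR (p - v))} := by
    ext ω
    simp only [hray, sub_eq_zero, Set.mem_ofPred_eq]
    refine exists_congr fun n => and_congr_right fun hn => ?_
    constructor
    · rintro ⟨ha, hb⟩ k hk
      exact ⟨ha k hk, hb k hk.le⟩
    · intro ha
      refine ⟨fun k hk => (ha k hk).1, fun k hk => ?_⟩
      rcases hk.lt_or_eq with h | rfl
      · exact (ha k h).2
      · rw [hn, sub_self]
        have : polarR 0 = 0 := by simp [polarR]
        rw [this]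
        exact mul_nonneg (by linarith) (polarR_nonneg _)
  rw [e1, e2, hfull, hdisk]
  refine ⟨ENNReal.ofReal_le_ofReal h1, ?_⟩
  rw [show (2 : ENNReal) = ENNReal.ofReal 2 by simp, ← ENNReal.ofReal_mul (by norm_num)]
  exact ENNReal.ofReal_le_ofReal h2
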